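/- For all n ≥ 1, k ≥ 1 and all μ ∈ wcomp_{n−1} with supp(μ) ⊆ [k], the Möbius function of the maximal interval [0̂, [n]^μ] of Π_n^k satisfies μ̄_{Π_n^k}(0̂, [n]^μ) = (−1)^{n−1} |Lyn_μ|, the signed number of colored Lyndon trees in BT_μ. -/

import Mathlib

/-! Weighted partition poset Π_n^k (raw representation).
Elements of [n] are represented by `Fin n` (the element j+1 ↔ index j) and
colors 1,…,k are represented by `Fin k` (color i+1 ↔ index i). -/

abbrev WP (n k : ℕ) := Finset (Finset (Fin n) × (Fin k → ℕ))

namespace WP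

variable {n k : ℕ}

/-- total weight `|μ|` of a weight vector supported in `[k]`. -/
def wsum (w : Fin k → ℕ) : ℕ := ∑ i, w i

/-- the raw finset is a genuine weighted partition of `[n]`. -/
def IsWP (π : WP n k) : Prop :=
  (∀ p ∈ π, p.1.Nonempty) ∧
  (∀ p ∈ π, ∀ q ∈ π, p ≠ q → Disjoint p.1 q.1) ∧
  (∀ x : Fin n, ∃ p ∈ π, x ∈ p.1) ∧
  (∀ p ∈ π, wsum p.2 + 1 = p.1.card)

/-- the order relation of `Π_n^k`. -/
def le (π ρ : WP n k) : Prop :=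
  IsWP π ∧ IsWP ρ ∧
  (∀ p ∈ π, ∃ q ∈ ρ, p.1 ⊆ q.1) ∧
  (∀ q ∈ ρ,
    (∀ i, (∑ p ∈ π.filter (fun p => p.1 ⊆ q.1), p.2 i) ≤ q.2 i) ∧
    (∑ i, (q.2 i - ∑ p ∈ π.filter (fun p => p.1 ⊆ q.1), p.2 i))
      = (π.filter (fun p => p.1 ⊆ q.1)).card - 1)

def lt (π ρ : WP n k) : Prop := le π ρ ∧ π ≠ ρ

/-- the minimum element `0̂` of `Π_n^k`. -/
def bot (n k : ℕ) : WP n k := Finset.univ.image (fun x => ({x}, fun _ => 0))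

/-- the maximal element `[n]^μ` of `Π_n^k`. -/
def top (n k : ℕ) (f : Fin k → ℕ) : WP n k := {(Finset.univ, f)}

-- `mobiusAux r m` iterates the defining recursion of the Möbius function of the
-- relation `r`, `m` times.  For `m` at least the length of the interval `[a,b]` this
-- computes the Möbius function `μ̄(a,b)` of the poset.
open Classical in
noncomputable def mobiusAux {Q : Type*} (r : Q → Q → Prop) : ℕ → Q → Q → ℤ
  | 0, a, b => if a = b then 1 else 0
  | m+1, a, b => if a = b then 1 else - ∑ᶠ c ∈ {c | r a c ∧ r c b ∧ c ≠ b}, mobiusAux r m a c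

/-- the Möbius function `μ̄_{Π_n^k}` (intervals of `Π_n^k` have length at most `n`). -/
noncomputable def mobius (a b : WP n k) : ℤ := mobiusAux le n a b

end WP

/-! Colored labeled binary trees.  Leaf labels are positive integers; colors are
natural numbers (the paper's color set ℙ = {1,2,…} is identified with ℕ via j ↦ j-1,
i.e. color index `i : ℕ` represents the paper's color `i+1`). -/

inductive CTree : Type
  | leaf (label : ℕ) : CTree
  | node (color : ℕ) (l r : CTree) : CTree
deriving DecidableEq

namespace CTree

/-- leaf labels from left to right -/
def leavesList : CTree → List ℕ
  | leaf m => [m]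
  | node _ l r => leavesList l ++ leavesList r

/-- the valency `v(x)`: smallest leaf label of the subtree -/
def minLeaf : CTree → ℕ
  | leaf m => m
  | node _ l r => min (minLeaf l) (minLeaf r)

/-- a tree is normalized if in every subtree the leftmost leaf carries the
smallest leaf label of the subtree. -/
def Normalized : CTree → Prop
  | leaf _ => True
  | node _ l r => Normalized l ∧ Normalized r ∧ minLeaf l < minLeaf r

/-- number of internal nodes with color `j` -/
def colorCount : CTree → ℕ → ℕ
  | leaf _, _ => 0
  | node c l r, j => (if c = j then 1 else 0) + colorCount l j + colorCount r j

def isLeafB : CTree → Bool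
  | leaf _ => true
  | node _ _ _ => false

def left : CTree → CTree
  | leaf m => leaf m
  | node _ l _ => l

def right : CTree → CTree
  | leaf m => leaf m
  | node _ _ r => r

def rootColor : CTree → ℕ
  | leaf _ => 0
  | node c _ _ => c

/-- the root of `T` is a Lyndon node: either the left child is a leaf
or `v(R(L(x))) > v(R(x))`. (Leaves count as Lyndon.) -/
def RootLyndonB (T : CTree) : Bool :=
  isLeafB T || isLeafB (left T) || decide (minLeaf (right T) < minLeaf (right (left T)))

/-- colored Lyndon condition: every internal node that is not a Lyndon node
satisfies `color(L(x)) > color(x)` -/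
def LynColored : CTree → Prop
  | leaf _ => True
  | node c l r => LynColored l ∧ LynColored r ∧
      (RootLyndonB (node c l r) = true ∨ c < rootColor l)

/-- colored comb condition: every internal node whose right child is internal
satisfies `color(x) > color(R(x))` -/
def CombColored : CTree → Prop
  | leaf _ => True
  | node c l r => CombColored l ∧ CombColored r ∧ (isLeafB r = true ∨ rootColor r < c)

/-- all colors equal to `0`: an (essentially) uncolored tree. -/
def Mono : CTree → Prop
  | leaf _ => True
  | node c l r => c = 0 ∧ Mono l ∧ Mono r

/-- the tree has leaf label set `[n] = {1,…,n}` (each label once) -/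
def OnSet (n : ℕ) (T : CTree) : Prop := T.leavesList.Perm ((List.range n).map (· + 1))

/-- `lynAux T = (b, m)`: `b` is the size of the block of `π^{Lyn}` containing the
root (`0` for a leaf) and `m` is the multiset of sizes of the other blocks. -/
def lynAux : CTree → ℕ × Multiset ℕ
  | leaf _ => (0, 0)
  | node c l r =>
    let bl := (lynAux l).1
    let ml := (lynAux l).2
    let br := (lynAux r).1
    let mr := (lynAux r).2
    let closedR := mr + (if br = 0 then 0 else {br})
    if RootLyndonB (node c l r) then
      (1, ml + (if bl = 0 then 0 else {bl}) + closedR)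
    else (1 + bl, ml + closedR)

/-- the Lyndon type `λ^{Lyn}`: multiset of block sizes of `π^{Lyn}` -/
def lynType (T : CTree) : Multiset ℕ :=
  (if (lynAux T).1 = 0 then (0 : Multiset ℕ) else {(lynAux T).1}) + (lynAux T).2

def combAux : CTree → ℕ × Multiset ℕ
  | leaf _ => (0, 0)
  | node _ l r =>
    let bl := (combAux l).1
    let ml := (combAux l).2
    let br := (combAux r).1
    let mr := (combAux r).2
    (1 + br, ml + mr + (if bl = 0 then 0 else {bl}))

/-- the comb type `λ^{Comb}`: multiset of block sizes of `π^{Comb}` -/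
def combType (T : CTree) : Multiset ℕ :=
  (if (combAux T).1 = 0 then (0 : Multiset ℕ) else {(combAux T).1}) + (combAux T).2

/-- subtrees (= nodes) of a tree -/
def subtreesC : CTree → List CTree
  | leaf m => [leaf m]
  | node c l r => node c l r :: (subtreesC l ++ subtreesC r)

end CTree

/-- normalized uncolored labeled binary trees on `[n]`: the set `Nor_n`. -/
def NorSet (n : ℕ) : Set CTree :=
  {T | T.OnSet n ∧ T.Normalized ∧ T.Mono}

/-- `Lyn_μ` for a weak composition `μ` (indexed by ℕ; `μ i` is the number of
internal nodes of color `i`). -/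
def LynSet (n : ℕ) (μ : ℕ →₀ ℕ) : Set CTree :=
  {T | T.OnSet n ∧ T.Normalized ∧ T.LynColored ∧ ∀ j, T.colorCount j = μ j}

/-- `Comb_μ` -/
def CombSet (n : ℕ) (μ : ℕ →₀ ℕ) : Set CTree :=
  {T | T.OnSet n ∧ T.Normalized ∧ T.CombColored ∧ ∀ j, T.colorCount j = μ j}

/-- `Lyn_μ` for `μ ∈ wcomp` with support in `[k]`, given as `f : Fin k → ℕ`. -/
def LynSetF (n k : ℕ) (f : Fin k → ℕ) : Set CTree :=
  {T | T.OnSet n ∧ T.Normalized ∧ T.LynColored ∧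
    ∀ j : ℕ, T.colorCount j = if h : j < k then f ⟨j, h⟩ else 0}

def CombSetF (n k : ℕ) (f : Fin k → ℕ) : Set CTree :=
  {T | T.OnSet n ∧ T.Normalized ∧ T.CombColored ∧
    ∀ j : ℕ, T.colorCount j = if h : j < k then f ⟨j, h⟩ else 0}

namespace LynP

open Finset

variable {n k : ℕ}

/-- leaf set inside `Fin n` -/
def ls (n : ℕ) : CTree → Finset (Fin n)
  | .leaf m => univ.filter (fun i => i.1 + 1 = m)
  | .node _ l r => ls n l ∪ ls n r

/-- color weight -/
def wt (k : ℕ) (T : CTree) : Fin k → ℕ := fun i => T.colorCount i.1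

/-- number of internal nodes -/
def nd : CTree → ℕ
  | .leaf _ => 0
  | .node _ l r => nd l + nd r + 1

/-- good trees: colored Lyndon trees with labels in `[n]`, colors in `[k]` -/
def Good (n k : ℕ) : CTree → Prop
  | .leaf m => 1 ≤ m ∧ m ≤ n
  | .node c l r => Good n k l ∧ Good n k r ∧ c < k ∧ Disjoint (ls n l) (ls n r) ∧
      l.minLeaf < r.minLeaf ∧ (CTree.RootLyndonB (.node c l r) = true ∨ c < l.rootColor)

theorem ls_leaf {m : ℕ} (h1 : 1 ≤ m) (h2 : m ≤ n) :
    ls n (.leaf m) = {(⟨m - 1, by omega⟩ : Fin n)} := by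
  ext i
  simp only [ls, mem_filter, mem_univ, true_and, mem_singleton, Fin.ext_iff]
  omega

theorem card_ls {T : CTree} (h : Good n k T) : (ls n T).card = nd T + 1 := by
  induction T with
  | leaf m => rw [ls_leaf h.1 h.2]; simp [nd]
  | node c l r ihl ihr =>
    obtain ⟨hl, hr, _, hd, _⟩ := h
    rw [ls, card_union_of_disjoint hd, ihl hl, ihr hr, nd]; omega

theorem wsum_wt {T : CTree} (h : Good n k T) : WP.wsum (wt k T) = nd T := by
  induction T with
  | leaf m => simp [WP.wsum, wt, nd, CTree.colorCount]
  | node c l r ihl ihr =>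
    obtain ⟨hl, hr, hc, _⟩ := h
    have h1 := ihl hl
    have h2 := ihr hr
    simp only [WP.wsum, wt, nd, CTree.colorCount, sum_add_distrib] at *
    rw [h1, h2]
    have : ∑ x : Fin k, (if c = x.1 then 1 else 0) = 1 := by
      rw [Finset.sum_eq_single (⟨c, hc⟩ : Fin k)] <;> simp [Fin.ext_iff]
      intro b hb hb'; exact hb hb'.symm
    rw [this]; omega

theorem ls_nonempty {T : CTree} (h : Good n k T) : (ls n T).Nonempty := by
  rw [← card_pos, card_ls h]; omega

theorem minLeaf_le {T : CTree} {i : Fin n} (h : i ∈ ls n T) : T.minLeaf ≤ i.1 + 1 := by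
  induction T with
  | leaf m => simp [ls] at h; simp [CTree.minLeaf, h]
  | node c l r ihl ihr =>
    rw [ls, mem_union] at h
    simp only [CTree.minLeaf]
    rcases h with h | h
    · exact (min_le_left _ _).trans (ihl h)
    · exact (min_le_right _ _).trans (ihr h)

theorem exists_minLeaf {T : CTree} (h : Good n k T) : ∃ i ∈ ls n T, i.1 + 1 = T.minLeaf := by
  induction T with
  | leaf m =>
    refine ⟨⟨m - 1, by have := h.1; have := h.2; omega⟩, ?_, ?_⟩
    · simp [ls]; have := h.1; omega
    · simp [CTree.minLeaf]; have := h.1; omega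
  | node c l r ihl ihr =>
    obtain ⟨i, hi, hi'⟩ := ihl h.1
    refine ⟨i, by rw [ls]; exact mem_union_left _ hi, ?_⟩
    have := h.2.2.2.2.1
    simp only [CTree.minLeaf]; omega

theorem minLeaf_ne {T T' : CTree} (h : Good n k T) (h' : Good n k T')
    (hd : Disjoint (ls n T) (ls n T')) : T.minLeaf ≠ T'.minLeaf := by
  intro he
  obtain ⟨i, hi, hi'⟩ := exists_minLeaf h
  obtain ⟨j, hj, hj'⟩ := exists_minLeaf h'
  have : i = j := by apply Fin.ext; omega
  subst this
  exact (Finset.disjoint_left.mp hd hi) hj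

theorem minLeaf_node {c : ℕ} {l r : CTree} (h : Good n k (.node c l r)) :
    (CTree.node c l r).minLeaf = l.minLeaf := by
  have := h.2.2.2.2.1
  simp only [CTree.minLeaf]; omega

theorem good_finite (n k : ℕ) : {T | Good n k T}.Finite := by
  classical
  let B : ℕ → Finset CTree := fun d => Nat.rec ((range (n+1)).image CTree.leaf)
    (fun _ S => S ∪ (range k ×ˢ S ×ˢ S).image (fun p => CTree.node p.1 p.2.1 p.2.2)) d
  have hB0 : B 0 = (range (n+1)).image CTree.leaf := rfl
  have hBs : ∀ d, B (d+1) = B d ∪ (range k ×ˢ B d ×ˢ B d).image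
    (fun p => CTree.node p.1 p.2.1 p.2.2) := fun d => rfl
  have hmono : Monotone B := monotone_nat_of_le_succ (fun d => by
    rw [hBs]; exact subset_union_left)
  have key : ∀ T, Good n k T → T ∈ B (nd T) := by
    intro T
    induction T with
    | leaf m =>
      intro h
      have := h.2
      simp [nd, hB0]; omega
    | node c l r ihl ihr =>
      intro h
      have h1 := hmono (show nd l ≤ nd l + nd r by omega) (ihl h.1)
      have h2 := hmono (show nd r ≤ nd l + nd r by omega) (ihr h.2.1)
      rw [nd, hBs, mem_union]
      right
      rw [mem_image]
      exact ⟨(c, l, r), by simp [h.2.2.1, h1, h2], rfl⟩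
  refine (B n).finite_toSet.subset ?_
  intro T hT
  have h1 := card_ls hT
  have h2 := card_le_univ (ls n T)
  simp at h2
  exact hmono (show nd T ≤ n by omega) (key T hT)

noncomputable def G (n k : ℕ) : Finset CTree := (good_finite n k).toFinset

theorem mem_G {T : CTree} : T ∈ G n k ↔ Good n k T := by simp [G]

def key (n k : ℕ) (T : CTree) : Finset (Fin n) × (Fin k → ℕ) := (ls n T, wt k T)

def sg (T : CTree) : ℤ := (-1) ^ nd T

/-- signed product -/
noncomputable def Phi (d : WP n k) : ℤ :=
  ∏ p ∈ d, ∑ T ∈ (G n k).filter (fun T => key n k T = p), sg T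

/-- forests below `c` -/
def Om (c : WP n k) (F : Finset CTree) : Prop :=
  (∀ T ∈ F, Good n k T) ∧
  (∀ T ∈ F, ∀ T' ∈ F, T ≠ T' → Disjoint (ls n T) (ls n T')) ∧
  (∀ x : Fin n, ∃ T ∈ F, x ∈ ls n T) ∧
  (∀ T ∈ F, ∃ q ∈ c, ls n T ⊆ q.1) ∧
  (∀ q ∈ c, ∀ i, ∑ T ∈ F.filter (fun T => ls n T ⊆ q.1), wt k T i ≤ q.2 i)

section wp
open WP

/-- sizes: a family of blocks inside `q` -/
theorem sum_card_filter {d c : WP n k} (hd : IsWP d) (hc : IsWP c)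
    (href : ∀ p ∈ d, ∃ q ∈ c, p.1 ⊆ q.1) {q : Finset (Fin n) × (Fin k → ℕ)} (hq : q ∈ c) :
    ∑ p ∈ d.filter (fun p => p.1 ⊆ q.1), p.1.card = q.1.card := by
  rw [← card_biUnion]
  · congr 1
    ext x
    simp only [mem_biUnion, mem_filter]
    constructor
    · rintro ⟨p, ⟨hp, hpq⟩, hx⟩; exact hpq hx
    · intro hx
      obtain ⟨p, hp, hxp⟩ := hd.2.2.1 x
      obtain ⟨q', hq', hpq⟩ := href p hp
      have : q' = q := by
        by_contra hne
        exact Finset.disjoint_left.mp (hc.2.1 q' hq' q hq hne) (hpq hxp) hx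
      subst this
      exact ⟨p, ⟨hp, hpq⟩, hxp⟩
  · intro p hp p' hp' hne
    exact hd.2.1 p (mem_filter.mp hp).1 p' (mem_filter.mp hp').1 hne

theorem sum_w_filter {d c : WP n k} (hd : IsWP d) (hc : IsWP c)
    (href : ∀ p ∈ d, ∃ q ∈ c, p.1 ⊆ q.1) {q : Finset (Fin n) × (Fin k → ℕ)} (hq : q ∈ c) :
    ∑ p ∈ d.filter (fun p => p.1 ⊆ q.1), wsum p.2 + (d.filter (fun p => p.1 ⊆ q.1)).card
      = q.1.card := by
  rw [← sum_card_filter hd hc href hq, card_eq_sum_ones, ← sum_add_distrib]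
  exact sum_congr rfl (fun p hp => hd.2.2.2 p (mem_filter.mp hp).1)

theorem le_of {d c : WP n k} (hd : IsWP d) (hc : IsWP c)
    (href : ∀ p ∈ d, ∃ q ∈ c, p.1 ⊆ q.1)
    (hw : ∀ q ∈ c, ∀ i, (∑ p ∈ d.filter (fun p => p.1 ⊆ q.1), p.2 i) ≤ q.2 i) :
    WP.le d c := by
  refine ⟨hd, hc, href, fun q hq => ⟨hw q hq, ?_⟩⟩
  have h1 := sum_w_filter hd hc href hq
  have h2 := hc.2.2.2 q hq
  have h3 : ∑ i, (q.2 i - ∑ p ∈ d.filter (fun p => p.1 ⊆ q.1), p.2 i) +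
      ∑ i, ∑ p ∈ d.filter (fun p => p.1 ⊆ q.1), p.2 i = ∑ i, q.2 i := by
    rw [← sum_add_distrib]
    exact sum_congr rfl (fun i _ => Nat.sub_add_cancel (hw q hq i))
  rw [sum_comm] at h3
  simp only [wsum] at h1 h2
  omega

theorem unique_block {c : WP n k} (hc : IsWP c) {q q' : Finset (Fin n) × (Fin k → ℕ)}
    (hq : q ∈ c) (hq' : q' ∈ c) {s : Finset (Fin n)} (hs : s.Nonempty)
    (h : s ⊆ q.1) (h' : s ⊆ q'.1) : q = q' := by
  by_contra hne
  obtain ⟨x, hx⟩ := hs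
  exact Finset.disjoint_left.mp (hc.2.1 q hq q' hq' hne) (h hx) (h' hx)

theorem filter_self {c : WP n k} (hc : IsWP c) {q : Finset (Fin n) × (Fin k → ℕ)} (hq : q ∈ c) :
    c.filter (fun p => p.1 ⊆ q.1) = {q} := by
  ext p
  simp only [mem_filter, mem_singleton]
  constructor
  · rintro ⟨hp, hs⟩
    exact unique_block hc hp hq (hc.1 p hp) subset_rfl hs
  · rintro rfl; exact ⟨hq, subset_rfl⟩

theorem le_refl' {c : WP n k} (hc : IsWP c) : WP.le c c := by
  refine le_of hc hc (fun p hp => ⟨p, hp, subset_rfl⟩) ?_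
  intro q hq i
  rw [filter_self hc hq]; simp

theorem isWP_bot : IsWP (bot n k) := by
  refine ⟨?_, ?_, ?_, ?_⟩
  · intro p hp
    simp only [bot, mem_image, mem_univ, true_and] at hp
    obtain ⟨x, rfl⟩ := hp
    simp
  · intro p hp q hq hne
    simp only [bot, mem_image, mem_univ, true_and] at hp hq
    obtain ⟨x, rfl⟩ := hp
    obtain ⟨y, rfl⟩ := hq
    simp only [disjoint_singleton]
    rintro rfl; exact hne rfl
  · intro x
    exact ⟨({x}, fun _ => 0), by simp [bot], by simp⟩
  · intro p hp
    simp only [bot, mem_image, mem_univ, true_and] at hp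
    obtain ⟨x, rfl⟩ := hp
    simp [wsum]

theorem bot_le' {d : WP n k} (hd : IsWP d) : WP.le (bot n k) d := by
  refine le_of isWP_bot hd ?_ ?_
  · intro p hp
    simp only [bot, mem_image, mem_univ, true_and] at hp
    obtain ⟨x, rfl⟩ := hp
    obtain ⟨q, hq, hx⟩ := hd.2.2.1 x
    exact ⟨q, hq, by simpa using hx⟩
  · intro q hq i
    rw [sum_eq_zero]
    · exact Nat.zero_le _
    · intro p hp
      have hp := (mem_filter.mp hp).1
      simp only [bot, mem_image, mem_univ, true_and] at hp
      obtain ⟨x, rfl⟩ := hp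
      rfl

theorem exists_big {c : WP n k} (hc : IsWP c) (hb : c ≠ bot n k) : ∃ q ∈ c, 2 ≤ q.1.card := by
  by_contra hcon
  push Not at hcon
  apply hb
  have h1 : ∀ q ∈ c, ∃ x, q = ({x}, fun _ => 0) := by
    intro q hq
    have h2 := hc.2.2.2 q hq
    have h3 := hcon q hq
    have h4 : q.1.card = 1 := by omega
    obtain ⟨x, hx⟩ := card_eq_one.mp h4
    refine ⟨x, Prod.ext hx ?_⟩
    have h5 : wsum q.2 = 0 := by omega
    funext i
    simp only [wsum, sum_eq_zero_iff, mem_univ, true_imp_iff] at h5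
    exact h5 i
  ext q
  simp only [bot, mem_image, mem_univ, true_and]
  constructor
  · intro hq; obtain ⟨x, hx⟩ := h1 q hq; exact ⟨x, hx.symm⟩
  · rintro ⟨x, rfl⟩
    obtain ⟨p, hp, hx⟩ := hc.2.2.1 x
    obtain ⟨y, rfl⟩ := h1 p hp
    simp at hx
    subst hx
    exact hp

theorem card_eq_sum_filter {d c : WP n k} (hd : IsWP d) (hc : IsWP c)
    (href : ∀ p ∈ d, ∃ q ∈ c, p.1 ⊆ q.1) :
    d.card = ∑ q ∈ c, (d.filter (fun p => p.1 ⊆ q.1)).card := by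
  rw [← card_biUnion]
  · congr 1
    ext p
    simp only [mem_biUnion, mem_filter]
    constructor
    · intro hp
      obtain ⟨q, hq, h⟩ := href p hp
      exact ⟨q, hq, hp, h⟩
    · rintro ⟨q, hq, hp, h⟩; exact hp
  · intro q hq q' hq' hne
    rw [Function.onFun, Finset.disjoint_left]
    intro p hp hp'
    rw [mem_filter] at hp hp'
    exact hne (unique_block hc hq hq' (hd.1 p hp.1) hp.2 hp'.2)

theorem sum_card_blocks {c : WP n k} (hc : IsWP c) : ∑ q ∈ c, q.1.card = n := by
  rw [← card_biUnion]
  · have : c.biUnion (fun q => q.1) = univ := by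
      ext x; simpa using hc.2.2.1 x
    rw [this]; simp
  · intro p hp q hq hne; exact hc.2.1 p hp q hq hne

theorem card_lt_of_big {c : WP n k} (hc : IsWP c) (hb : c ≠ bot n k) : c.card < n := by
  obtain ⟨q, hq, h2⟩ := exists_big hc hb
  have h := sum_card_blocks hc
  have : ∑ q ∈ c, 1 < ∑ q ∈ c, q.1.card :=
    sum_lt_sum (fun p hp => card_pos.mpr (hc.1 p hp)) ⟨q, hq, by omega⟩
  rw [← card_eq_sum_ones] at this
  omega

theorem card_lt_of_lt {d c : WP n k} (h : WP.le d c) (hne : d ≠ c) : c.card < d.card := by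
  obtain ⟨hd, hc, href, hw⟩ := h
  by_contra hcon
  apply hne
  have hcard := card_eq_sum_filter hd hc href
  have hpos : ∀ q ∈ c, 1 ≤ (d.filter (fun p => p.1 ⊆ q.1)).card := by
    intro q hq
    by_contra h0
    have h0 : d.filter (fun p => p.1 ⊆ q.1) = ∅ := by
      rw [← card_eq_zero]; omega
    have h1 := sum_card_filter hd hc href hq
    have h2 := card_pos.mpr (hc.1 q hq)
    rw [h0] at h1; simp at h1; omega
  have h1 : ∀ q ∈ c, (d.filter (fun p => p.1 ⊆ q.1)).card = 1 := by
    by_contra hx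
    push Not at hx
    obtain ⟨q, hq, hq1⟩ := hx
    have : ∑ q ∈ c, 1 < ∑ q ∈ c, (d.filter (fun p => p.1 ⊆ q.1)).card :=
      sum_lt_sum hpos ⟨q, hq, by have := hpos q hq; omega⟩
    rw [← card_eq_sum_ones] at this
    omega
  have h2 : ∀ q ∈ c, q ∈ d := by
    intro q hq
    obtain ⟨p, hp⟩ := card_eq_one.mp (h1 q hq)
    have hpm : p ∈ d.filter (fun p => p.1 ⊆ q.1) := by rw [hp]; simp
    rw [mem_filter] at hpm
    have h3 := sum_card_filter hd hc href hq
    obtain ⟨h4, h5⟩ := hw q hq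
    rw [hp] at h3 h4 h5
    simp only [sum_singleton, card_singleton, Nat.sub_self, sum_eq_zero_iff, mem_univ,
      true_imp_iff] at h3 h4 h5
    have : p = q := by
      apply Prod.ext
      · exact eq_of_subset_of_card_le hpm.2 h3.ge
      · funext i; have := h4 i; have := h5 i; omega
    rw [← this]; exact hpm.1
  exact (eq_of_subset_of_card_le h2 (by omega)).symm

theorem finite_isWP (n k : ℕ) : {d : WP n k | IsWP d}.Finite := by
  classical
  refine ((univ ×ˢ Fintype.piFinset (fun _ : Fin k => range (n+1))).powerset).finite_toSet.subset ?_
  intro d hd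
  simp only [coe_powerset, Set.mem_preimage, Set.mem_powerset_iff]
  intro p hp
  have h1 := hd.2.2.2 p hp
  have h2 := card_le_univ p.1
  simp at h2
  simp only [coe_product, Set.mem_prod, mem_coe, mem_univ, true_and, Fintype.mem_piFinset, mem_range]
  intro i
  have : p.2 i ≤ wsum p.2 := single_le_sum (f := p.2) (fun _ _ => Nat.zero_le _) (mem_univ i)
  omega

end wp

section involution
open WP

/-- total weight of the trees of `F` inside block `q` -/
def W (F : Finset CTree) (q : Finset (Fin n) × (Fin k → ℕ)) (i : Fin k) : ℕ :=
  ∑ T ∈ F.filter (fun T => ls n T ⊆ q.1), wt k T i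

theorem root_iff {a b : ℕ} {l r t : CTree} :
    CTree.RootLyndonB (.node a (.node b l r) t) = true ↔ t.minLeaf < r.minLeaf := by
  have h : CTree.RootLyndonB (.node a (.node b l r) t) = decide (t.minLeaf < r.minLeaf) := rfl
  rw [h, decide_eq_true_iff]

theorem W_insert {F : Finset CTree} {T : CTree} (hT : T ∉ F)
    (q : Finset (Fin n) × (Fin k → ℕ)) (i : Fin k) :
    W (insert T F) q i = (if ls n T ⊆ q.1 then wt k T i else 0) + W F q i := by
  unfold W
  rw [filter_insert]
  split_ifs with h
  · rw [sum_insert (by simp [hT])]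
  · simp

/-- compatible data: `T1,T2` merge to a node of color `a` -/
def Dat (q : Finset (Fin n) × (Fin k → ℕ)) (H : Finset CTree) (T1 T2 : CTree) (a : ℕ) : Prop :=
  T1 ∉ H ∧ T2 ∉ H ∧ CTree.node a T1 T2 ∉ H ∧ T1 ≠ T2 ∧ Good n k (.node a T1 T2) ∧
    ls n (.node a T1 T2) ⊆ q.1

theorem W_pair {q : Finset (Fin n) × (Fin k → ℕ)} {H : Finset CTree} {T1 T2 : CTree} {a : ℕ}
    (h : Dat q H T1 T2 a) (i : Fin k) :
    W (insert (.node a T1 T2) H) q i =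
      W (insert T1 (insert T2 H)) q i + (if a = i.1 then 1 else 0) := by
  obtain ⟨h1, h2, h3, h4, h5, h6⟩ := h
  have h6' := h6
  rw [ls] at h6'
  rw [W_insert h3, W_insert (by simp [h1, h4]), W_insert h2, if_pos h6,
    if_pos (subset_union_left.trans h6'), if_pos (subset_union_right.trans h6')]
  simp only [wt, CTree.colorCount]
  omega

theorem W_other {c : WP n k} (hc : IsWP c)
    {q q' : Finset (Fin n) × (Fin k → ℕ)} (hq : q ∈ c) (hq' : q' ∈ c) (hne : q' ≠ q)
    {H : Finset CTree} {T1 T2 : CTree} {a : ℕ}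
    (h : Dat q H T1 T2 a) (i : Fin k) :
    W (insert (.node a T1 T2) H) q' i = W (insert T1 (insert T2 H)) q' i := by
  obtain ⟨h1, h2, h3, h4, h5, h6⟩ := h
  have h6' := h6
  rw [ls] at h6'
  have aux : ∀ T, Good n k T → ls n T ⊆ q.1 → ¬ ls n T ⊆ q'.1 := fun T hT hs hs' =>
    hne (unique_block hc hq' hq (ls_nonempty hT) hs' hs)
  rw [W_insert h3, W_insert (by simp [h1, h4]), W_insert h2, if_neg (aux _ h5 h6),
    if_neg (aux _ h5.1 (subset_union_left.trans h6')),
    if_neg (aux _ h5.2.1 (subset_union_right.trans h6'))]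
  omega

theorem om_up {c : WP n k} (hc : IsWP c) {q : Finset (Fin n) × (Fin k → ℕ)} (hq : q ∈ c)
    {H : Finset CTree} {T1 T2 : CTree} {a : ℕ} (h : Dat q H T1 T2 a)
    (hF : Om c (insert T1 (insert T2 H)))
    (ha : ∀ i : Fin k, i.1 = a → W (insert T1 (insert T2 H)) q i < q.2 i) :
    Om c (insert (.node a T1 T2) H) := by
  have hh := h
  obtain ⟨h1, h2, h3, h4, h5, h6⟩ := h
  obtain ⟨o1, o2, o3, o4, o5⟩ := hF
  have hdis : ∀ T ∈ H, Disjoint (ls n (.node a T1 T2)) (ls n T) := by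
    intro T hT
    rw [ls, disjoint_union_left]
    exact ⟨o2 T1 (by simp) T (by simp [hT]) (fun e => h1 (e ▸ hT)),
      o2 T2 (by simp) T (by simp [hT]) (fun e => h2 (e ▸ hT))⟩
  refine ⟨?_, ?_, ?_, ?_, ?_⟩
  · intro T hT
    rcases mem_insert.mp hT with rfl | hT
    · exact h5
    · exact o1 T (by simp [hT])
  · intro T hT T' hT' hne
    rcases mem_insert.mp hT with rfl | hT <;> rcases mem_insert.mp hT' with rfl | hT'
    · exact absurd rfl hne
    · exact hdis _ hT'
    · exact (hdis _ hT).symm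
    · exact o2 T (by simp [hT]) T' (by simp [hT']) hne
  · intro x
    obtain ⟨T, hT, hx⟩ := o3 x
    simp only [mem_insert] at hT
    rcases hT with rfl | rfl | hT
    · exact ⟨_, mem_insert_self _ _, by rw [ls]; exact mem_union_left _ hx⟩
    · exact ⟨_, mem_insert_self _ _, by rw [ls]; exact mem_union_right _ hx⟩
    · exact ⟨T, by simp [hT], hx⟩
  · intro T hT
    rcases mem_insert.mp hT with rfl | hT
    · exact ⟨q, hq, h6⟩
    · exact o4 T (by simp [hT])
  · intro q' hq' i
    change W _ q' i ≤ _
    have o := o5 q' hq' i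
    change W _ q' i ≤ _ at o
    by_cases hne : q' = q
    · subst hne
      rw [W_pair hh]
      split_ifs with hai
      · exact ha i hai.symm
      · exact o
    · rw [W_other hc hq hq' hne hh]; exact o

theorem om_down {c : WP n k} (hc : IsWP c) {q : Finset (Fin n) × (Fin k → ℕ)} (hq : q ∈ c)
    {H : Finset CTree} {T1 T2 : CTree} {a : ℕ} (h : Dat q H T1 T2 a)
    (hF : Om c (insert (.node a T1 T2) H)) :
    Om c (insert T1 (insert T2 H)) := by
  have hh := h
  obtain ⟨h1, h2, h3, h4, h5, h6⟩ := h
  obtain ⟨o1, o2, o3, o4, o5⟩ := hF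
  have h6' := h6
  rw [ls] at h6'
  have hdis : ∀ T ∈ H, Disjoint (ls n T1) (ls n T) ∧ Disjoint (ls n T2) (ls n T) := by
    intro T hT
    have := o2 (.node a T1 T2) (by simp) T (by simp [hT]) (fun e => h3 (e ▸ hT))
    rwa [ls, disjoint_union_left] at this
  refine ⟨?_, ?_, ?_, ?_, ?_⟩
  · intro T hT
    simp only [mem_insert] at hT
    rcases hT with rfl | rfl | hT
    · exact h5.1
    · exact h5.2.1
    · exact o1 T (by simp [hT])
  · intro T hT T' hT' hne
    simp only [mem_insert] at hT hT'
    rcases hT with rfl | rfl | hT <;> rcases hT' with rfl | rfl | hT'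
    · exact absurd rfl hne
    · exact h5.2.2.2.1
    · exact (hdis _ hT').1
    · exact h5.2.2.2.1.symm
    · exact absurd rfl hne
    · exact (hdis _ hT').2
    · exact (hdis _ hT).1.symm
    · exact (hdis _ hT).2.symm
    · exact o2 T (by simp [hT]) T' (by simp [hT']) hne
  · intro x
    obtain ⟨T, hT, hx⟩ := o3 x
    simp only [mem_insert] at hT
    rcases hT with rfl | hT
    · rw [ls, mem_union] at hx
      rcases hx with hx | hx
      · exact ⟨T1, by simp, hx⟩
      · exact ⟨T2, by simp, hx⟩
    · exact ⟨T, by simp [hT], hx⟩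
  · intro T hT
    simp only [mem_insert] at hT
    rcases hT with rfl | rfl | hT
    · exact ⟨q, hq, subset_union_left.trans h6'⟩
    · exact ⟨q, hq, subset_union_right.trans h6'⟩
    · exact o4 T (by simp [hT])
  · intro q' hq' i
    change W _ q' i ≤ _
    have o := o5 q' hq' i
    change W _ q' i ≤ _ at o
    by_cases hne : q' = q
    · subst hne
      rw [W_pair hh] at o
      omega
    · rw [W_other hc hq hq' hne hh] at o; exact o

/-- the matching relation on forests -/
def Rel (q : Finset (Fin n) × (Fin k → ℕ)) (F F' : Finset CTree) : Prop :=
  ∃ H T1 T2 a, Dat q H T1 T2 a ∧ F = insert T1 (insert T2 H) ∧ F' = insert (.node a T1 T2) H ∧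
    (∀ T ∈ H, ls n T ⊆ q.1 → T2.minLeaf < T.minLeaf) ∧
    (∀ i : Fin k, W F' q i < q.2 i → a ≤ i.1)

theorem rel_up {c : WP n k} {q : Finset (Fin n) × (Fin k → ℕ)} (hq : q ∈ c)
    {F F' : Finset CTree} (hF' : Om c F') (h : Rel q F F') :
    ∃ T1 T2 a, T1 ∈ F ∧ T2 ∈ F ∧ ls n T1 ⊆ q.1 ∧ ls n T2 ⊆ q.1 ∧ T1.minLeaf < T2.minLeaf ∧
      (∀ T ∈ F, ls n T ⊆ q.1 → T = T1 ∨ T = T2 ∨ T2.minLeaf < T.minLeaf) ∧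
      (∃ i : Fin k, i.1 = a ∧ W F q i < q.2 i) ∧ (∀ i : Fin k, W F q i < q.2 i → a ≤ i.1) ∧
      (CTree.RootLyndonB (.node a T1 T2) = true ∨ a < T1.rootColor) ∧
      F' = insert (.node a T1 T2) ((F.erase T1).erase T2) := by
  obtain ⟨H, T1, T2, a, hD, rfl, rfl, hm, hcol⟩ := h
  have hDD := hD
  obtain ⟨h1, h2, h3, h4, h5, h6⟩ := hD
  rw [ls] at h6
  refine ⟨T1, T2, a, by simp, by simp, subset_union_left.trans h6, subset_union_right.trans h6,
    h5.2.2.2.2.1, ?_, ⟨⟨a, h5.2.2.1⟩, rfl, ?_⟩, ?_, h5.2.2.2.2.2, ?_⟩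
  · intro T hT hs
    simp only [mem_insert] at hT
    rcases hT with rfl | rfl | hT
    · exact Or.inl rfl
    · exact Or.inr (Or.inl rfl)
    · exact Or.inr (Or.inr (hm T hT hs))
  · have o : W _ q _ ≤ _ := hF'.2.2.2.2 q hq ⟨a, h5.2.2.1⟩
    rw [W_pair hDD, if_pos rfl] at o
    exact o
  · intro i hi
    by_cases hai : a = i.1
    · omega
    · apply hcol
      rw [W_pair hDD, if_neg hai]
      exact hi
  · rw [erase_insert (by simp [h1, h4]), erase_insert h2]

theorem rel_down {q : Finset (Fin n) × (Fin k → ℕ)}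
    {F F' : Finset CTree} (h : Rel q F F') :
    ∃ T1 T2 a, CTree.node a T1 T2 ∈ F' ∧ ls n (.node a T1 T2) ⊆ q.1 ∧
      (CTree.node a T1 T2).minLeaf < T2.minLeaf ∧
      (∀ T ∈ F', ls n T ⊆ q.1 → T = .node a T1 T2 ∨ T2.minLeaf < T.minLeaf) ∧
      (∀ i : Fin k, W F' q i < q.2 i → a ≤ i.1) ∧
      F = insert T1 (insert T2 (F'.erase (.node a T1 T2))) := by
  obtain ⟨H, T1, T2, a, hD, rfl, rfl, hm, hcol⟩ := h
  obtain ⟨h1, h2, h3, h4, h5, h6⟩ := hD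
  refine ⟨T1, T2, a, by simp, h6, ?_, ?_, hcol, ?_⟩
  · rw [minLeaf_node h5]; exact h5.2.2.2.2.1
  · intro T hT hs
    rcases mem_insert.mp hT with rfl | hT
    · exact Or.inl rfl
    · exact Or.inr (hm T hT hs)
  · rw [erase_insert h3]

theorem uniq_up {c : WP n k} {q : Finset (Fin n) × (Fin k → ℕ)} (hq : q ∈ c)
    {F F1 F2 : Finset CTree} (hF1 : Om c F1) (hF2 : Om c F2) (h1 : Rel q F F1) (h2 : Rel q F F2) :
    F1 = F2 := by
  obtain ⟨A, B, a, hA, hB, sA, sB, hlt, hmin, ⟨i, hi, hiW⟩, hcol, _, rfl⟩ := rel_up hq hF1 h1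
  obtain ⟨A', B', a', hA', hB', sA', sB', hlt', hmin', ⟨i', hi', hiW'⟩, hcol', _, rfl⟩ :=
    rel_up hq hF2 h2
  have e1 : A = A' := by
    have x := hmin A' hA' sA'
    have y := hmin' A hA sA
    rcases x with x | rfl | x
    · exact x.symm
    · rcases y with y | rfl | y
      · exact y
      · omega
      · omega
    · rcases y with y | rfl | y
      · exact y
      · omega
      · omega
  subst e1
  have e2 : B = B' := by
    have x := hmin B' hB' sB'
    have y := hmin' B hB sB
    rcases x with rfl | x | x
    · omega
    · exact x.symm
    · rcases y with rfl | y | y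
      · omega
      · exact y
      · omega
  subst e2
  have e3 : a = a' := by
    have x := hcol i' hiW'
    have y := hcol' i hiW
    omega
  rw [e3]

theorem uniq_down {q : Finset (Fin n) × (Fin k → ℕ)}
    {F F1 F2 : Finset CTree} (h1 : Rel q F1 F) (h2 : Rel q F2 F) :
    F1 = F2 := by
  obtain ⟨A, B, a, hA, sA, hlt, hmin, hcol, rfl⟩ := rel_down h1
  obtain ⟨A', B', a', hA', sA', hlt', hmin', hcol', rfl⟩ := rel_down h2
  have e : CTree.node a A B = CTree.node a' A' B' := by
    rcases hmin _ hA' sA' with x | x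
    · exact x.symm
    · rcases hmin' _ hA sA with y | y
      · exact y
      · omega
  rw [e]
  injection e with e1 e2 e3
  rw [e2, e3]

theorem not_both {c : WP n k} {q : Finset (Fin n) × (Fin k → ℕ)} (hq : q ∈ c)
    {F F1 F2 : Finset CTree} (hF1 : Om c F1) (h1 : Rel q F F1) (h2 : Rel q F2 F) : False := by
  obtain ⟨A, B, a, hA, hB, sA, sB, hlt, hmin, ⟨i, hi, hiW⟩, hcol, hroot, rfl⟩ := rel_up hq hF1 h1
  obtain ⟨A', B', a', hA', sA', hlt', hmin', hcol', rfl⟩ := rel_down h2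
  have e : A = CTree.node a' A' B' := by
    rcases hmin' A hA sA with x | x
    · exact x
    · rcases hmin _ hA' sA' with y | y | y
      · exact y.symm
      · rw [y] at hlt'; omega
      · omega
  subst e
  have x : B'.minLeaf < B.minLeaf := by
    rcases hmin' B hB sB with rfl | x
    · omega
    · exact x
  have y := hcol' i hiW
  rw [root_iff] at hroot
  simp only [CTree.rootColor] at hroot
  omega

theorem om_le {c : WP n k} (hc : IsWP c) {F : Finset CTree} (h : Om c F) :
    Set.InjOn (key n k) F ∧ WP.le (F.image (key n k)) c := by
  obtain ⟨o1, o2, o3, o4, o5⟩ := h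
  have hinj : Set.InjOn (key n k) F := by
    intro T hT T' hT' he
    by_contra hne
    have hd := o2 T hT T' hT' hne
    have : ls n T = ls n T' := congrArg Prod.fst he
    rw [← this, disjoint_self_iff_empty] at hd
    exact (ls_nonempty (o1 T hT)).ne_empty hd
  refine ⟨hinj, le_of ⟨?_, ?_, ?_, ?_⟩ hc ?_ ?_⟩
  · intro p hp
    obtain ⟨T, hT, rfl⟩ := mem_image.mp hp
    exact ls_nonempty (o1 T hT)
  · intro p hp p' hp' hne
    obtain ⟨T, hT, rfl⟩ := mem_image.mp hp
    obtain ⟨T', hT', rfl⟩ := mem_image.mp hp'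
    exact o2 T hT T' hT' (fun e => hne (by rw [e]))
  · intro x
    obtain ⟨T, hT, hx⟩ := o3 x
    exact ⟨key n k T, mem_image_of_mem _ hT, hx⟩
  · intro p hp
    obtain ⟨T, hT, rfl⟩ := mem_image.mp hp
    simp only [key]
    rw [wsum_wt (o1 T hT), card_ls (o1 T hT)]
  · intro p hp
    obtain ⟨T, hT, rfl⟩ := mem_image.mp hp
    exact o4 T hT
  · intro q hq i
    rw [filter_image, sum_image]
    · exact o5 q hq i
    · intro T hT T' hT' he
      simp only [coe_filter, Set.mem_ofPred_eq] at hT hT'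
      exact hinj hT.1 hT'.1 he

theorem om_of {c : WP n k} {F : Finset CTree} (hg : ∀ T ∈ F, Good n k T)
    (hinj : Set.InjOn (key n k) F) (h : WP.le (F.image (key n k)) c) : Om c F := by
  obtain ⟨⟨w1, w2, w3, w4⟩, hc, href, hw⟩ := h
  refine ⟨hg, ?_, ?_, ?_, ?_⟩
  · intro T hT T' hT' hne
    exact w2 _ (mem_image_of_mem _ hT) _ (mem_image_of_mem _ hT')
      (fun e => hne (hinj hT hT' e))
  · intro x
    obtain ⟨p, hp, hx⟩ := w3 x
    obtain ⟨T, hT, rfl⟩ := mem_image.mp hp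
    exact ⟨T, hT, hx⟩
  · intro T hT
    exact href _ (mem_image_of_mem _ hT)
  · intro q hq i
    have := (hw q hq).1 i
    rw [filter_image, sum_image] at this
    · exact this
    · intro T hT T' hT' he
      simp only [coe_filter, Set.mem_ofPred_eq] at hT hT'
      exact hinj hT.1 hT'.1 he

theorem om_resid {c : WP n k} (hc : IsWP c) {F : Finset CTree} (h : Om c F)
    {q : Finset (Fin n) × (Fin k → ℕ)} (hq : q ∈ c) :
    ∑ i, (q.2 i - W F q i) = (F.filter (fun T => ls n T ⊆ q.1)).card - 1 := by
  obtain ⟨hinj, -, -, -, hw⟩ := om_le hc h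
  have := (hw q hq).2
  have hinj' : Set.InjOn (key n k) (F.filter (fun T => ls n T ⊆ q.1)) := by
    intro T hT T' hT' he
    simp only [coe_filter, Set.mem_ofPred_eq] at hT hT'
    exact hinj hT.1 hT'.1 he
  rw [filter_image] at this
  have e : ∀ i, ∑ p ∈ (F.filter (fun T => ls n T ⊆ q.1)).image (key n k), p.2 i = W F q i := by
    intro i
    rw [sum_image hinj']; rfl
  have e2 := card_image_of_injOn hinj'
  rw [← e2]
  refine Eq.trans ?_ this
  exact sum_congr rfl (fun i _ => by rw [← e i]; rfl)

theorem nd_left (a : ℕ) (l r : CTree) : CTree.node a l r ≠ l ∧ CTree.node a l r ≠ r := by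
  constructor <;> intro h <;> have := congrArg nd h <;> simp only [nd] at this <;> omega

theorem exists_partner {c : WP n k} (hc : IsWP c) {q : Finset (Fin n) × (Fin k → ℕ)} (hq : q ∈ c)
    (hbig : 2 ≤ q.1.card) {F : Finset CTree} (hF : Om c F) :
    ∃ F', Om c F' ∧ (Rel q F F' ∨ Rel q F' F) := by
  have hFF := hF
  obtain ⟨o1, o2, o3, o4, o5⟩ := hF
  have hres := om_resid hc hFF hq
  set A := F.filter (fun T => ls n T ⊆ q.1) with hA
  have hcov : ∀ x ∈ q.1, ∃ T ∈ A, x ∈ ls n T := by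
    intro x hx
    obtain ⟨T, hT, hxT⟩ := o3 x
    obtain ⟨q', hq', hs⟩ := o4 T hT
    have : q' = q := unique_block hc hq' hq (singleton_nonempty x) (by simpa using hs hxT)
      (by simpa using hx)
    subst this
    exact ⟨T, mem_filter.mpr ⟨hT, hs⟩, hxT⟩
  have hAne : A.Nonempty := by
    obtain ⟨x, hx⟩ := hc.1 q hq
    obtain ⟨T, hT, -⟩ := hcov x hx
    exact ⟨T, hT⟩
  obtain ⟨T1, hT1, hmin1⟩ := exists_min_image A CTree.minLeaf hAne
  obtain ⟨hT1F, hT1q⟩ := mem_filter.mp hT1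
  -- detaching step
  have detach : ∀ a l r, T1 = .node a l r →
      (∀ T ∈ F, ls n T ⊆ q.1 → T ≠ T1 → r.minLeaf < T.minLeaf) →
      (∀ i : Fin k, W F q i < q.2 i → a ≤ i.1) →
      ∃ F', Om c F' ∧ (Rel q F F' ∨ Rel q F' F) := by
    intro a l r he hm hcol
    have hg := o1 T1 hT1F
    rw [he] at hg
    have hls : ls n T1 = ls n l ∪ ls n r := by rw [he, ls]
    have hnl : ∀ T, Good n k T → ls n T ⊆ ls n T1 → T ≠ T1 → T ∉ F.erase T1 := by
      intro T hT hs hne hmem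
      have hd := o2 T (mem_of_mem_erase hmem) T1 hT1F hne
      exact (ls_nonempty hT).ne_empty (disjoint_self_iff_empty _ |>.mp (hd.mono_right hs))
    have hDat : Dat q (F.erase T1) l r a := by
      refine ⟨?_, ?_, ?_, ?_, hg, ?_⟩
      · exact hnl l hg.1 (by rw [hls]; exact subset_union_left)
          (by rw [he]; exact (nd_left a l r).1.symm)
      · exact hnl r hg.2.1 (by rw [hls]; exact subset_union_right)
          (by rw [he]; exact (nd_left a l r).2.symm)
      · rw [← he]; simp
      · rintro rfl; exact lt_irrefl _ hg.2.2.2.2.1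
      · rw [← he]; exact hT1q
    have hins : F = insert (.node a l r) (F.erase T1) := by
      rw [← he, insert_erase hT1F]
    refine ⟨insert l (insert r (F.erase T1)), om_down hc hq hDat (hins ▸ hFF), Or.inr ?_⟩
    refine ⟨F.erase T1, l, r, a, hDat, rfl, hins, ?_, hcol⟩
    intro T hT hs
    exact hm T (mem_of_mem_erase hT) hs (ne_of_mem_erase hT)
  by_cases hone : A = {T1}
  · rw [hone] at hres
    simp only [card_singleton, Nat.sub_self, sum_eq_zero_iff, mem_univ, true_imp_iff] at hres
    cases hT : T1 with
    | leaf m =>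
      exfalso
      have hg := o1 T1 hT1F
      have h1 := card_ls hg
      have hs : q.1 ⊆ ls n T1 := by
        intro x hx
        obtain ⟨T, hTA, hxT⟩ := hcov x hx
        rw [hone, mem_singleton] at hTA
        rwa [← hTA]
      have h2 := card_le_card hs
      rw [hT] at h1 h2
      simp only [nd] at h1
      omega
    | node a l r =>
      refine detach a l r hT ?_ ?_
      · intro T hTF hs hne
        have : T ∈ A := mem_filter.mpr ⟨hTF, hs⟩
        rw [hone, mem_singleton] at this
        exact absurd this hne
      · intro i hi
        have := hres i
        omega
  · have hBne : (A.erase T1).Nonempty := by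
      rw [nonempty_iff_ne_empty]
      intro h0
      rw [erase_eq_empty_iff] at h0
      rcases h0 with h0 | h0
      · exact hAne.ne_empty h0
      · exact hone h0
    obtain ⟨T2, hT2, hmin2⟩ := exists_min_image (A.erase T1) CTree.minLeaf hBne
    obtain ⟨hne21, hT2A⟩ := mem_erase.mp hT2
    obtain ⟨hT2F, hT2q⟩ := mem_filter.mp hT2A
    have hres1 : ∃ i, W F q i < q.2 i := by
      by_contra hcon
      push Not at hcon
      have : ∑ i, (q.2 i - W F q i) = 0 := sum_eq_zero (fun i _ => Nat.sub_eq_zero_of_le (hcon i))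
      have h1 := card_pos.mpr hBne
      rw [card_erase_of_mem hT1] at h1
      omega
    obtain ⟨i0, hi0⟩ := hres1
    obtain ⟨i, hiS, himin⟩ := exists_min_image (univ.filter (fun i : Fin k => W F q i < q.2 i))
      (fun i => i.1) ⟨i0, by simp [hi0]⟩
    have hi : W F q i < q.2 i := (mem_filter.mp hiS).2
    have himin' : ∀ j : Fin k, W F q j < q.2 j → i.1 ≤ j.1 := fun j hj =>
      himin j (mem_filter.mpr ⟨mem_univ _, hj⟩)
    have hd12 := o2 T1 hT1F T2 hT2F hne21.symm
    have hlt12 : T1.minLeaf < T2.minLeaf :=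
      lt_of_le_of_ne (hmin1 T2 hT2A) (minLeaf_ne (o1 T1 hT1F) (o1 T2 hT2F) hd12)
    by_cases hroot : CTree.RootLyndonB (.node i.1 T1 T2) = true ∨ i.1 < T1.rootColor
    · have hg : Good n k (.node i.1 T1 T2) :=
        ⟨o1 T1 hT1F, o1 T2 hT2F, i.2, hd12, hlt12, hroot⟩
      have hF2 : F = insert T1 (insert T2 ((F.erase T1).erase T2)) := by
        rw [insert_erase (mem_erase.mpr ⟨hne21, hT2F⟩), insert_erase hT1F]
      have hDat : Dat q ((F.erase T1).erase T2) T1 T2 i.1 := by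
        refine ⟨by simp, by simp, ?_, hne21.symm, hg, ?_⟩
        · intro hmem
          have hmemF := mem_of_mem_erase (mem_of_mem_erase hmem)
          have hd := o2 _ hmemF T1 hT1F (nd_left _ _ _).1
          rw [ls, disjoint_union_left] at hd
          exact (ls_nonempty (o1 T1 hT1F)).ne_empty (disjoint_self_iff_empty _ |>.mp hd.1)
        · rw [ls]; exact union_subset hT1q hT2q
      refine ⟨insert (.node i.1 T1 T2) ((F.erase T1).erase T2), ?_, Or.inl ?_⟩
      · refine om_up hc hq hDat (hF2 ▸ hFF) ?_
        rw [← hF2]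
        intro j hj
        have : j = i := Fin.ext hj
        rw [this]; exact hi
      · refine ⟨_, T1, T2, i.1, hDat, hF2, rfl, ?_, ?_⟩
        · intro T hT hs
          have hT' := mem_erase.mp hT
          have hT'' := mem_erase.mp hT'.2
          have hle := hmin2 T (mem_erase.mpr ⟨hT''.1, mem_filter.mpr ⟨hT''.2, hs⟩⟩)
          exact lt_of_le_of_ne hle (minLeaf_ne (o1 T2 hT2F) (o1 T hT''.2)
            (o2 T2 hT2F T hT''.2 hT'.1.symm))
        · intro j hj
          rw [W_pair hDat, ← hF2] at hj
          exact himin' j (by omega)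
    · push Not at hroot
      obtain ⟨hr1, hr2⟩ := hroot
      cases hT : T1 with
      | leaf m =>
        rw [hT] at hr1
        simp [CTree.RootLyndonB, CTree.isLeafB, CTree.left] at hr1
      | node a l r =>
        have hg := o1 T1 hT1F
        have hr3 : r.minLeaf < T2.minLeaf := by
          rw [hT] at hr1 hg hd12
          rw [ne_eq, root_iff, not_lt] at hr1
          rw [ls, disjoint_union_left] at hd12
          exact lt_of_le_of_ne hr1 (minLeaf_ne hg.2.1 (o1 T2 hT2F) hd12.2)
        refine detach a l r hT ?_ ?_
        · intro T hTF hs hne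
          exact lt_of_lt_of_le hr3 (hmin2 T (mem_erase.mpr ⟨hne, mem_filter.mpr ⟨hTF, hs⟩⟩))
        · intro j hj
          have h1 := himin' j hj
          rw [hT] at hr2
          simp only [CTree.rootColor] at hr2
          omega

theorem rel_sign {q : Finset (Fin n) × (Fin k → ℕ)} {F F' : Finset CTree} (h : Rel q F F') :
    ∏ T ∈ F, sg T + ∏ T ∈ F', sg T = 0 := by
  obtain ⟨H, T1, T2, a, ⟨h1, h2, h3, h4, h5, h6⟩, rfl, rfl, -, -⟩ := h
  rw [prod_insert (by simp [h1, h4]), prod_insert h2, prod_insert h3]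
  simp only [sg, nd, pow_add, pow_one]
  ring

open Classical in
/-- finite set of forests below `c` -/
noncomputable def Oms (c : WP n k) : Finset (Finset CTree) :=
  (G n k).powerset.filter (fun F => Om c F)

theorem mem_Oms {c : WP n k} {F : Finset CTree} : F ∈ Oms c ↔ Om c F := by
  simp only [Oms, mem_filter, mem_powerset, and_iff_right_iff_imp]
  intro h T hT
  exact mem_G.mpr (h.1 T hT)

theorem sum_Oms {c : WP n k} (hc : IsWP c) (hb : c ≠ bot n k) :
    ∑ F ∈ Oms c, ∏ T ∈ F, sg T = 0 := by
  obtain ⟨q, hq, hbig⟩ := exists_big hc hb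
  have hex : ∀ F ∈ Oms c, ∃ F', Om c F' ∧ (Rel q F F' ∨ Rel q F' F) := fun F hF =>
    exists_partner hc hq hbig (mem_Oms.mp hF)
  choose g hg1 hg2 using hex
  have huniq : ∀ F F1 F2, Om c F → Om c F1 → Om c F2 → (Rel q F F1 ∨ Rel q F1 F) →
      (Rel q F F2 ∨ Rel q F2 F) → F1 = F2 := by
    intro F F1 F2 hF hF1 hF2 h1 h2
    rcases h1 with h1 | h1 <;> rcases h2 with h2 | h2
    · exact uniq_up hq hF1 hF2 h1 h2
    · exact (not_both hq hF1 h1 h2).elim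
    · exact (not_both hq hF2 h2 h1).elim
    · exact uniq_down h1 h2
  have hsign : ∀ F hF, ∏ T ∈ F, sg T + ∏ T ∈ g F hF, sg T = 0 := by
    intro F hF
    rcases hg2 F hF with h | h
    · exact rel_sign h
    · rw [add_comm]; exact rel_sign h
  refine sum_involution g hsign ?_ (fun F hF => mem_Oms.mpr (hg1 F hF)) ?_
  · intro F hF hne he
    have := hsign F hF
    rw [he] at this
    omega
  · intro F hF
    have hgF := mem_Oms.mpr (hg1 F hF)
    exact huniq (g F hF) _ _ (hg1 F hF) (hg1 _ hgF) (mem_Oms.mp hF) (hg2 _ hgF)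
      (hg2 F hF).symm

end involution

section final
open WP

/-- number of forests with prescribed type -/
theorem phi_eq {d c : WP n k} (hdc : WP.le d c) :
    ∑ F ∈ (Oms c).filter (fun F => F.image (key n k) = d), ∏ T ∈ F, sg T = Phi d := by
  classical
  rw [Phi, prod_sum]
  symm
  have hL : ∀ φ ∈ d.pi (fun p => (G n k).filter (fun T => key n k T = p)),
      ∀ p (hp : p ∈ d), Good n k (φ p hp) ∧ key n k (φ p hp) = p := by
    intro φ hφ p hp
    have := mem_pi.mp hφ p hp
    rw [mem_filter, mem_G] at this
    exact this
  have himg : ∀ φ ∈ d.pi (fun p => (G n k).filter (fun T => key n k T = p)),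
      (d.attach.image (fun p => φ p.1 p.2)).image (key n k) = d := by
    intro φ hφ
    rw [image_image]
    ext p
    simp only [mem_image, mem_attach, true_and, Function.comp]
    constructor
    · rintro ⟨x, rfl⟩
      rw [(hL φ hφ x.1 x.2).2]; exact x.2
    · intro hp; exact ⟨⟨p, hp⟩, (hL φ hφ p hp).2⟩
  refine sum_bij (fun φ _ => d.attach.image (fun p => φ p.1 p.2)) ?_ ?_ ?_ ?_
  · intro φ hφ
    rw [mem_filter, mem_Oms]
    refine ⟨om_of ?_ ?_ ?_, himg φ hφ⟩
    · intro T hT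
      obtain ⟨p, -, rfl⟩ := mem_image.mp hT
      exact (hL φ hφ p.1 p.2).1
    · intro T hT T' hT' he
      obtain ⟨p, -, rfl⟩ := mem_image.mp hT
      obtain ⟨p', -, rfl⟩ := mem_image.mp hT'
      rw [(hL φ hφ p.1 p.2).2, (hL φ hφ p'.1 p'.2).2] at he
      rw [Subtype.ext he]
    · rw [himg φ hφ]; exact hdc
  · intro φ hφ ψ hψ he
    funext p hp
    have h1 : φ p hp ∈ d.attach.image (fun p => φ p.1 p.2) :=
      mem_image.mpr ⟨⟨p, hp⟩, mem_attach _ _, rfl⟩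
    rw [he] at h1
    obtain ⟨p', -, h2⟩ := mem_image.mp h1
    have h3 := (hL ψ hψ p'.1 p'.2).2
    rw [h2, (hL φ hφ p hp).2] at h3
    subst h3
    exact h2.symm
  · intro F hF
    rw [mem_filter, mem_Oms] at hF
    obtain ⟨hF, hFd⟩ := hF
    have hinj := (om_le hdc.2.1 hF).1
    have hex : ∀ p ∈ d, ∃ T ∈ F, key n k T = p := by
      intro p hp
      rw [← hFd] at hp
      exact mem_image.mp hp
    choose φ hφ1 hφ2 using hex
    refine ⟨φ, ?_, ?_⟩
    · rw [mem_pi]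
      intro p hp
      rw [mem_filter, mem_G]
      exact ⟨hF.1 _ (hφ1 p hp), hφ2 p hp⟩
    · ext T
      simp only [mem_image, mem_attach, true_and]
      constructor
      · rintro ⟨p, rfl⟩; exact hφ1 p.1 p.2
      · intro hT
        have hk : key n k T ∈ d := by rw [← hFd]; exact mem_image_of_mem _ hT
        exact ⟨⟨key n k T, hk⟩, hinj (hφ1 _ hk) hT (hφ2 _ hk)⟩
  · intro φ hφ
    rw [prod_image]
    intro p _ p' _ he
    have h1 := (hL φ hφ p.1 p.2).2
    simp only at he
    rw [he, (hL φ hφ p'.1 p'.2).2] at h1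
    exact Subtype.ext h1.symm

theorem finite_le (c : WP n k) : {d : WP n k | WP.le d c}.Finite :=
  (finite_isWP n k).subset (fun _ hd => hd.1)

theorem sum_phi {c : WP n k} (hc : IsWP c) (hb : c ≠ bot n k) :
    ∑ d ∈ (finite_le c).toFinset, Phi d = 0 := by
  classical
  rw [← sum_Oms hc hb]
  rw [← sum_fiberwise_of_maps_to (s := Oms c) (t := (finite_le c).toFinset)
    (g := fun F => F.image (key n k))]
  · refine sum_congr rfl (fun d hd => ?_)
    rw [Set.Finite.mem_toFinset] at hd
    rw [← phi_eq hd]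
  · intro F hF
    rw [Set.Finite.mem_toFinset]
    exact (om_le hc (mem_Oms.mp hF)).2

theorem phi_bot : Phi (bot n k) = 1 := by
  rw [Phi]
  refine prod_eq_one ?_
  intro p hp
  simp only [bot, mem_image, mem_univ, true_and] at hp
  obtain ⟨x, rfl⟩ := hp
  have : (G n k).filter (fun T => key n k T = ({x}, fun _ => 0)) = {CTree.leaf (x.1 + 1)} := by
    ext T
    rw [mem_filter, mem_G, mem_singleton]
    constructor
    · rintro ⟨hg, hk⟩
      have h1 : ls n T = {x} := congrArg Prod.fst hk
      have h2 := card_ls hg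
      rw [h1, card_singleton] at h2
      cases T with
      | leaf m =>
        have : x ∈ ls n (.leaf m) := by rw [h1]; simp
        simp [ls] at this
        rw [this]
      | node a l r => simp only [nd] at h2; omega
    · rintro rfl
      refine ⟨⟨by omega, x.2⟩, ?_⟩
      refine Prod.ext ?_ ?_
      · simp only [key]
        rw [ls_leaf (by omega) (by have := x.2; omega)]
        simp
      · funext i; simp [key, wt, CTree.colorCount]
  rw [this, sum_singleton]
  simp [sg, nd]

theorem mobius_eq (m : ℕ) : ∀ c : WP n k, IsWP c → n ≤ m + c.card →
    mobiusAux WP.le m (bot n k) c = Phi c := by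
  classical
  induction m with
  | zero =>
    intro c hc h
    have : c = bot n k := by
      by_contra hb
      have := card_lt_of_big hc hb
      omega
    subst this
    simp [mobiusAux, phi_bot]
  | succ m ih =>
    intro c hc h
    by_cases hb : c = bot n k
    · subst hb; simp [mobiusAux, phi_bot]
    · rw [mobiusAux, if_neg (fun e => hb e.symm)]
      have hset : {d : WP n k | WP.le (bot n k) d ∧ WP.le d c ∧ d ≠ c} =
          ((finite_le c).toFinset.erase c : Finset (WP n k)) := by
        ext d
        simp only [Set.mem_ofPred_eq, coe_erase, Set.Finite.coe_toFinset, Set.mem_sdiff,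
          Set.mem_singleton_iff]
        constructor
        · rintro ⟨_, h1, h2⟩; exact ⟨h1, h2⟩
        · rintro ⟨h1, h2⟩; exact ⟨bot_le' h1.1, h1, h2⟩
      rw [hset, finsum_mem_coe_finset]
      have h1 : ∑ d ∈ (finite_le c).toFinset.erase c, mobiusAux WP.le m (bot n k) d =
          ∑ d ∈ (finite_le c).toFinset.erase c, Phi d := by
        refine sum_congr rfl (fun d hd => ?_)
        rw [mem_erase, Set.Finite.mem_toFinset] at hd
        have h2 := card_lt_of_lt hd.2 hd.1
        exact ih d hd.2.1 (by omega)
      rw [h1]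
      have h3 := sum_phi hc hb
      have hmem : c ∈ (finite_le c).toFinset := by
        rw [Set.Finite.mem_toFinset]; exact le_refl' hc
      rw [← add_sum_erase _ _ hmem] at h3
      omega

theorem mem_ls {T : CTree} {i : Fin n} : i ∈ ls n T ↔ i.1 + 1 ∈ T.leavesList := by
  induction T with
  | leaf m => simp [ls, CTree.leavesList]
  | node c l r ihl ihr => simp [ls, CTree.leavesList, ihl, ihr]

theorem good_iff {T : CTree} : Good n k T ↔ T.Normalized ∧ T.LynColored ∧ T.leavesList.Nodup ∧
    (∀ x ∈ T.leavesList, 1 ≤ x ∧ x ≤ n) ∧ (∀ j, k ≤ j → T.colorCount j = 0) := by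
  induction T with
  | leaf m => simp [Good, CTree.Normalized, CTree.LynColored, CTree.leavesList, CTree.colorCount]
  | node c l r ihl ihr =>
    simp only [Good, CTree.Normalized, CTree.LynColored, CTree.leavesList, CTree.colorCount,
      ihl, ihr, List.nodup_append', List.mem_append]
    constructor
    · rintro ⟨⟨a1, a2, a3, a4, a5⟩, ⟨b1, b2, b3, b4, b5⟩, hc, hd, hm, hr⟩
      refine ⟨⟨a1, b1, hm⟩, ⟨a2, b2, hr⟩, ⟨a3, b3, ?_⟩, ?_, ?_⟩
      · intro x hx hx'
        have h1 := a4 x hx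
        have e : x = (⟨x - 1, by omega⟩ : Fin n).1 + 1 := by simp; omega
        rw [e, ← mem_ls] at hx hx'
        exact Finset.disjoint_left.mp hd hx hx'
      · rintro x (hx | hx)
        · exact a4 x hx
        · exact b4 x hx
      · intro j hj
        rw [a5 j hj, b5 j hj, if_neg (by omega)]
    · rintro ⟨⟨a1, b1, hm⟩, ⟨a2, b2, hr⟩, ⟨a3, b3, hd⟩, h4, h5⟩
      have hj : ∀ j, k ≤ j → c ≠ j ∧ l.colorCount j = 0 ∧ r.colorCount j = 0 := by
        intro j hj
        have := h5 j hj
        split_ifs at this with hcj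
        · omega
        · exact ⟨hcj, by omega, by omega⟩
      refine ⟨⟨a1, a2, a3, fun x hx => h4 x (Or.inl hx), fun j h => (hj j h).2.1⟩,
        ⟨b1, b2, b3, fun x hx => h4 x (Or.inr hx), fun j h => (hj j h).2.2⟩, ?_, ?_, hm, hr⟩
      · by_contra hk
        exact (hj c (by omega)).1 rfl
      · rw [Finset.disjoint_left]
        intro i hi hi'
        rw [mem_ls] at hi hi'
        exact hd hi hi'

theorem lynSetF_eq (f : Fin k → ℕ) :
    LynSetF n k f = ((G n k).filter (fun T => key n k T = (univ, f)) : Finset CTree) := by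
  ext T
  rw [mem_coe, mem_filter, mem_G, good_iff]
  simp only [LynSetF, Set.mem_ofPred_eq, CTree.OnSet]
  have hnd : ((List.range n).map (· + 1)).Nodup :=
    List.nodup_range.map (fun a b h => by simpa using h)
  constructor
  · rintro ⟨h1, h2, h3, h4⟩
    have hm : ∀ x, x ∈ T.leavesList ↔ 1 ≤ x ∧ x ≤ n := by
      intro x
      rw [h1.mem_iff]
      simp only [List.mem_map, List.mem_range]
      constructor
      · rintro ⟨a, ha, rfl⟩; omega
      · intro hx; exact ⟨x - 1, by omega, by omega⟩
    refine ⟨⟨h2, h3, h1.nodup_iff.mpr hnd, fun x hx => (hm x).mp hx, ?_⟩, ?_⟩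
    · intro j hj
      rw [h4 j, dif_neg (by omega)]
    · refine Prod.ext ?_ ?_
      · ext i
        simp only [key, mem_ls, mem_univ, iff_true, hm]
        omega
      · funext i
        simp only [key, wt, h4, i.2, dif_pos]
  · rintro ⟨⟨h1, h2, h3, h4, h5⟩, hk⟩
    have hk1 : ls n T = univ := congrArg Prod.fst hk
    have hk2 : wt k T = f := congrArg Prod.snd hk
    refine ⟨?_, h1, h2, ?_⟩
    · rw [List.perm_ext_iff_of_nodup h3 hnd]
      intro x
      simp only [List.mem_map, List.mem_range]
      constructor
      · intro hx; have := h4 x hx; exact ⟨x - 1, by omega, by omega⟩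
      · rintro ⟨a, ha, rfl⟩
        have : (⟨a, ha⟩ : Fin n) ∈ ls n T := by rw [hk1]; simp
        exact mem_ls.mp this
    · intro j
      split_ifs with hj
      · rw [← hk2]; rfl
      · exact h5 j (by omega)

end final

end LynP

/-- For every `n, k ≥ 1` and every weak composition `μ ∈ wcomp_{n-1}` with
`supp(μ) ⊆ [k]` (represented by `f : Fin k → ℕ` with `Σ f = n-1`), the Möbius
function of the maximal interval `[0̂, [n]^μ]` of `Π_n^k` is
`(-1)^{n-1}` times the number of colored Lyndon trees in `BT_μ`. -/
theorem mobius_eq_signed_card_coloredLyndonTrees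
    (n k : ℕ) (hn : 1 ≤ n) (hk : 1 ≤ k) (f : Fin k → ℕ) (hf : (∑ i, f i) = n - 1) :
    WP.mobius (WP.bot n k) (WP.top n k f) =
      (-1 : ℤ) ^ (n - 1) * Nat.card (LynSetF n k f) := by
  have hW : WP.IsWP (WP.top n k f) := by
    refine ⟨?_, ?_, ?_, ?_⟩
    · intro p hp
      rw [WP.top, Finset.mem_singleton] at hp
      subst hp
      exact ⟨⟨0, hn⟩, Finset.mem_univ _⟩
    · intro p hp q hq hne
      rw [WP.top, Finset.mem_singleton] at hp hq
      exact absurd (hp.trans hq.symm) hne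
    · intro x
      exact ⟨_, Finset.mem_singleton_self _, Finset.mem_univ _⟩
    · intro p hp
      rw [WP.top, Finset.mem_singleton] at hp
      subst hp
      simp only [WP.wsum, hf, Finset.card_univ, Fintype.card_fin]
      omega
  rw [WP.mobius, LynP.mobius_eq n _ hW (by omega), LynP.lynSetF_eq, LynP.Phi, WP.top,
    Finset.prod_singleton]
  rw [Nat.card_eq_card_toFinset, Finset.toFinset_coe, mul_comm, ← nsmul_eq_mul]
  refine Finset.sum_eq_card_nsmul ?_
  intro T hT
  rw [Finset.mem_filter, LynP.mem_G] at hT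
  have h1 := LynP.card_ls hT.1
  have h2 : LynP.ls n T = Finset.univ := congrArg Prod.fst hT.2
  rw [h2, Finset.card_univ, Fintype.card_fin] at h1
  rw [LynP.sg, show LynP.nd T = n - 1 by omega]
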